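/- arXiv:1903.04331 — 2 statements merged into one kernel-verified Lean document; each statement's English description precedes it below -/
import Mathlib

section
/- For every q ∈ (1, ∞) and every γ ∈ (−1, q−1] there exists a constant C > 0 (depending only on q and γ) such that: for every n ≥ 1, every σ = (λ_1, …, λ_n) ∈ D^n with r = max_i |λ_i|, and every z ∈ ℂ with |z| ≤ 1, the derivative of the reproducing kernel k_z^B (B = B_σ) satisfies ‖(k_z^B)'‖_{A^q(γ)} ≤ C · (n/(1−r))^{2−(γ+2)/q}. (Proposition 4.1, part (3).) -/
open Complex Metric

noncomputable section

/-- The elementary Blaschke factor `b_λ(z) = (λ - z)/(1 - conj(λ) z)`. -/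
def blaschkeF (l z : ℂ) : ℂ := (l - z) / (1 - (starRingEnd ℂ) l * z)

/-- The finite Blaschke product `B_σ = ∏ b_{λ_i}`. -/
def blaschkeProd {n : ℕ} (σ : Fin n → ℂ) (z : ℂ) : ℂ := ∏ i, blaschkeF (σ i) z

/-- The reproducing kernel of the model space `K_{B_σ}`:
`k_z^B(w) = (1 - conj(B(z)) B(w))/(1 - conj(z) w)`. -/
def modelKernel {n : ℕ} (σ : Fin n → ℂ) (z w : ℂ) : ℂ :=
  (1 - (starRingEnd ℂ) (blaschkeProd σ z) * blaschkeProd σ w) /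
    (1 - (starRingEnd ℂ) z * w)

/-- The radial-weighted Bergman norm
`‖f‖_{A^q(γ)} = (∫_D |f|^q (1-|z|^2)^γ dA)^{1/q}`, `dA` normalized area measure. -/
def bergmanNorm (q γ : ℝ) (f : ℂ → ℂ) : ℝ :=
  (Real.pi⁻¹ * ∫ z in ball (0:ℂ) 1, ‖f z‖ ^ q * (1 - ‖z‖ ^ 2) ^ γ) ^ (1 / q)

section BlaschkeEstimates

variable {l z w : ℂ} {n : ℕ} {σ : Fin n → ℂ} {r : ℝ}

lemma one_sub_norm_le_norm_one_sub_conj_mul (hw : ‖w‖ ≤ 1) :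
    1 - ‖l‖ ≤ ‖1 - (starRingEnd ℂ) l * w‖ := by
  have h := norm_sub_norm_le (1 : ℂ) ((starRingEnd ℂ) l * w)
  rw [norm_one, norm_mul, RCLike.norm_conj] at h
  nlinarith [norm_nonneg l]

lemma one_sub_conj_mul_ne_zero (hl : ‖l‖ < 1) (hw : ‖w‖ ≤ 1) :
    1 - (starRingEnd ℂ) l * w ≠ 0 :=
  norm_pos_iff.1 ((sub_pos.2 hl).trans_le (one_sub_norm_le_norm_one_sub_conj_mul hw))

lemma one_sub_conj_mul_ne_zero' (hz : ‖z‖ ≤ 1) (hw : ‖w‖ < 1) :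
    1 - (starRingEnd ℂ) z * w ≠ 0 := by
  have h := one_sub_conj_mul_ne_zero hw hz
  contrapose! h
  simpa [mul_comm] using congrArg (starRingEnd ℂ) h

lemma norm_blaschkeF_le_one (hl : ‖l‖ < 1) (hw : ‖w‖ ≤ 1) : ‖blaschkeF l w‖ ≤ 1 := by
  rw [blaschkeF, norm_div]
  refine div_le_one_of_le₀ ?_ (norm_nonneg _)
  refine abs_le_of_sq_le_sq' ?_ (norm_nonneg _) |>.2
  have h1 : ‖l‖ ^ 2 < 1 := by nlinarith [norm_nonneg l]
  have h2 : ‖w‖ ^ 2 ≤ 1 := by nlinarith [norm_nonneg w]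
  rw [Complex.sq_norm, Complex.normSq_apply] at h1 h2 ⊢
  rw [Complex.sq_norm, Complex.normSq_apply]
  simp
  nlinarith [mul_nonneg (sub_nonneg.2 h1.le) (sub_nonneg.2 h2)]

lemma norm_blaschkeProd_le_one (hσ : ∀ i, ‖σ i‖ < 1) (hw : ‖w‖ ≤ 1) :
    ‖blaschkeProd σ w‖ ≤ 1 := by
  rw [blaschkeProd, norm_prod]
  exact Finset.prod_le_one (fun _ _ => norm_nonneg _)
    fun i _ => norm_blaschkeF_le_one (hσ i) hw

lemma hasDerivAt_one_sub_conj_mul (l w : ℂ) :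
    HasDerivAt (fun w => 1 - (starRingEnd ℂ) l * w) (-(starRingEnd ℂ) l) w := by
  simpa using ((hasDerivAt_id w).const_mul ((starRingEnd ℂ) l)).const_sub 1

lemma hasDerivAt_blaschkeF (hl : ‖l‖ < 1) (hw : ‖w‖ ≤ 1) :
    HasDerivAt (blaschkeF l)
      (-((1 - ‖l‖ ^ 2 : ℝ) : ℂ) / (1 - (starRingEnd ℂ) l * w) ^ 2) w := by
  have h := ((hasDerivAt_id w).const_sub l).div (hasDerivAt_one_sub_conj_mul l w)
    (one_sub_conj_mul_ne_zero hl hw)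
  refine h.congr_deriv ?_
  have : ((‖l‖ ^ 2 : ℝ) : ℂ) = (starRingEnd ℂ) l * l := by
    rw [← Complex.normSq_eq_conj_mul_self, Complex.normSq_eq_norm_sq]
  push_cast at this ⊢
  rw [this]
  simp only [id]
  ring

lemma norm_deriv_blaschkeF_le (hl : ‖l‖ ≤ r) (hr : r < 1) (hw : ‖w‖ ≤ 1) :
    ‖deriv (blaschkeF l) w‖ ≤ 2 / (1 - r) := by
  have hl1 := hl.trans_lt hr
  rw [(hasDerivAt_blaschkeF hl1 hw).deriv, norm_div, norm_neg, norm_pow, Complex.norm_real,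
    Real.norm_of_nonneg (by nlinarith [norm_nonneg l])]
  have h := one_sub_norm_le_norm_one_sub_conj_mul (l := l) hw
  have h0 : 0 < 1 - ‖l‖ := by linarith
  calc (1 - ‖l‖ ^ 2) / ‖1 - (starRingEnd ℂ) l * w‖ ^ 2 ≤ (2 * (1 - ‖l‖)) / (1 - ‖l‖) ^ 2 := by
        gcongr
        nlinarith [norm_nonneg l]
    _ = 2 / (1 - ‖l‖) := by field_simp
    _ ≤ 2 / (1 - r) := by
        have : 0 < 1 - r := by linarith
        gcongr

lemma differentiableAt_blaschkeProd (hσ : ∀ i, ‖σ i‖ < 1) (hw : ‖w‖ ≤ 1) :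
    DifferentiableAt ℂ (blaschkeProd σ) w := by
  unfold blaschkeProd
  exact DifferentiableAt.fun_finsetProd
    fun i _ => (hasDerivAt_blaschkeF (hσ i) hw).differentiableAt

lemma blaschkeProd_castSucc (σ : Fin (n + 1) → ℂ) (w : ℂ) :
    blaschkeProd σ w =
      blaschkeProd (fun i => σ i.castSucc) w * blaschkeF (σ (Fin.last n)) w :=
  Fin.prod_univ_castSucc _

lemma norm_deriv_blaschkeProd_le (hσ : ∀ i, ‖σ i‖ ≤ r) (hr : r < 1) (hw : ‖w‖ ≤ 1) :
    ‖deriv (blaschkeProd σ) w‖ ≤ n * (2 / (1 - r)) := by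
  induction n with
  | zero => simp [show blaschkeProd σ = fun _ => 1 from funext fun _ => by simp [blaschkeProd]]
  | succ n ih =>
    have hσ1 : ∀ i, ‖σ i‖ < 1 := fun i => (hσ i).trans_lt hr
    rw [show blaschkeProd σ = fun w => _ from funext (blaschkeProd_castSucc σ),
      deriv_fun_mul (differentiableAt_blaschkeProd (fun i => hσ1 _) hw)
        (hasDerivAt_blaschkeF (hσ1 _) hw).differentiableAt]
    refine (norm_add_le _ _).trans ?_
    rw [norm_mul, norm_mul]
    have h0 : 0 ≤ 2 / (1 - r) := div_nonneg two_pos.le (by linarith)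
    have h1 := mul_le_mul (ih (σ := fun i => σ i.castSucc) fun i => hσ _)
      (norm_blaschkeF_le_one (hσ1 (Fin.last n)) hw) (norm_nonneg _) (by positivity)
    have h2 := mul_le_mul (norm_blaschkeProd_le_one (σ := fun i => σ i.castSucc)
      (fun i => hσ1 _) hw)
      (norm_deriv_blaschkeF_le (hσ (Fin.last n)) hr hw) (norm_nonneg _) zero_le_one
    push_cast
    linarith

lemma norm_deriv_blaschkeProd_le_div (hσ : ∀ i, ‖σ i‖ < 1) (hw : ‖w‖ < 1) :
    ‖deriv (blaschkeProd σ) w‖ ≤ 1 / (1 - ‖w‖) := by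
  have hsub : ∀ x ∈ closedBall w (1 - ‖w‖), ‖x‖ ≤ 1 := fun x hx => by
    have h := norm_sub_norm_le x w
    rw [mem_closedBall, dist_eq_norm] at hx
    linarith
  refine Complex.norm_deriv_le_of_forall_mem_sphere_norm_le (sub_pos.2 hw)
    (DifferentiableOn.diffContOnCl fun x hx => ?_)
    fun x hx => norm_blaschkeProd_le_one hσ (hsub x (sphere_subset_closedBall hx))
  exact (differentiableAt_blaschkeProd hσ
    (hsub x (closure_ball_subset_closedBall hx))).differentiableWithinAt

/-- A factorized form of the reproducing kernel of the one-dimensional model space `K_{b_λ}`. -/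
lemma one_sub_conj_blaschkeF_mul_blaschkeF (hl : ‖l‖ < 1) (hz : ‖z‖ ≤ 1) (hw : ‖w‖ ≤ 1) :
    1 - (starRingEnd ℂ) (blaschkeF l z) * blaschkeF l w =
      (1 - (starRingEnd ℂ) z * w) * (((1 - ‖l‖ ^ 2 : ℝ) : ℂ) /
        ((starRingEnd ℂ) (1 - (starRingEnd ℂ) l * z) * (1 - (starRingEnd ℂ) l * w))) := by
  have h1 := (map_ne_zero (starRingEnd ℂ)).2 (one_sub_conj_mul_ne_zero hl hz)
  have h2 := one_sub_conj_mul_ne_zero hl hw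
  have : ((‖l‖ ^ 2 : ℝ) : ℂ) = (starRingEnd ℂ) l * l := by
    rw [← Complex.normSq_eq_conj_mul_self, Complex.normSq_eq_norm_sq]
  push_cast at this ⊢
  rw [this, blaschkeF, blaschkeF, map_div₀]
  simp only [map_sub, map_mul, map_one, Complex.conj_conj] at h1 ⊢
  have h1' : 1 - (starRingEnd ℂ) z * l ≠ 0 := by rwa [mul_comm]
  field_simp
  ring

lemma modelKernel_castSucc {σ : Fin (n + 1) → ℂ} (hσ : ∀ i, ‖σ i‖ < 1) (hz : ‖z‖ ≤ 1)
    (hw : ‖w‖ < 1) :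
    modelKernel σ z w = modelKernel (fun i => σ i.castSucc) z w +
      (starRingEnd ℂ) (blaschkeProd (fun i => σ i.castSucc) z) *
        (((1 - ‖σ (Fin.last n)‖ ^ 2 : ℝ) : ℂ) /
          (starRingEnd ℂ) (1 - (starRingEnd ℂ) (σ (Fin.last n)) * z)) *
      (blaschkeProd (fun i => σ i.castSucc) w *
        (1 - (starRingEnd ℂ) (σ (Fin.last n)) * w)⁻¹) := by
  have h0 := one_sub_conj_mul_ne_zero' hz hw
  have h := one_sub_conj_blaschkeF_mul_blaschkeF (hσ (Fin.last n)) hz hw.le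
  rw [modelKernel, modelKernel, blaschkeProd_castSucc, blaschkeProd_castSucc, map_mul,
    div_eq_iff h0, add_mul, div_mul_cancel₀ _ h0]
  rw [div_mul_eq_div_div, div_eq_mul_inv _ (1 - _ * w)] at h
  linear_combination (starRingEnd ℂ) (blaschkeProd (fun i => σ i.castSucc) z) *
    blaschkeProd (fun i => σ i.castSucc) w * h

lemma hasDerivAt_modelKernel (hσ : ∀ i, ‖σ i‖ < 1) (hz : ‖z‖ ≤ 1) (hw : ‖w‖ < 1) :
    HasDerivAt (modelKernel σ z)
      (-((starRingEnd ℂ) (blaschkeProd σ z) * deriv (blaschkeProd σ) w) /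
          (1 - (starRingEnd ℂ) z * w) +
        (1 - (starRingEnd ℂ) (blaschkeProd σ z) * blaschkeProd σ w) * (starRingEnd ℂ) z /
          (1 - (starRingEnd ℂ) z * w) ^ 2) w := by
  have h0 := one_sub_conj_mul_ne_zero' hz hw
  refine ((((differentiableAt_blaschkeProd hσ hw.le).hasDerivAt.const_mul
    ((starRingEnd ℂ) (blaschkeProd σ z))).const_sub 1).div
      (hasDerivAt_one_sub_conj_mul z w) h0).congr_deriv ?_
  field_simp
  ring

lemma norm_deriv_modelKernel_le_sq (hσ : ∀ i, ‖σ i‖ ≤ r) (hr : r < 1) (hz : ‖z‖ ≤ 1)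
    (hw : ‖w‖ < 1) : ‖deriv (modelKernel σ z) w‖ ≤ 4 * (n / (1 - r)) ^ 2 := by
  induction n with
  | zero =>
    have : modelKernel σ z = fun _ => 0 := by
      funext; simp [modelKernel, blaschkeProd]
    simp [this]
  | succ n ih =>
    have hσ1 : ∀ i, ‖σ i‖ < 1 := fun i => (hσ i).trans_lt hr
    set τ : Fin n → ℂ := fun i => σ i.castSucc
    set l := σ (Fin.last n)
    have hτ1 : ∀ i, ‖τ i‖ < 1 := fun i => hσ1 _
    have hev : modelKernel σ z =ᶠ[nhds w] _ :=
      Filter.eventually_of_mem (isOpen_ball.mem_nhds (mem_ball_zero_iff.2 hw))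
        fun x hx => modelKernel_castSucc hσ1 hz (mem_ball_zero_iff.1 hx)
    have hd := (hasDerivAt_one_sub_conj_mul l w).inv (one_sub_conj_mul_ne_zero (hσ1 _) hw.le)
    have hB := (differentiableAt_blaschkeProd hτ1 hw.le).hasDerivAt
    have hk := (hasDerivAt_modelKernel hτ1 hz hw).differentiableAt.hasDerivAt
    rw [((hk.add ((hB.mul hd).const_mul _)).congr_of_eventuallyEq hev).deriv]
    refine (norm_add_le _ _).trans ?_
    have hs : 0 < 1 - r := by linarith
    have hlr : ‖l‖ ≤ r := hσ _
    have hκz : ‖((1 - ‖l‖ ^ 2 : ℝ) : ℂ) / (starRingEnd ℂ) (1 - (starRingEnd ℂ) l * z)‖ ≤ 2 := by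
      have h := one_sub_norm_le_norm_one_sub_conj_mul (l := l) hz
      rw [norm_div, RCLike.norm_conj, Complex.norm_real,
        Real.norm_of_nonneg (by nlinarith [norm_nonneg l]), div_le_iff₀ (by linarith)]
      nlinarith [norm_nonneg l]
    have hpos : 1 - r ≤ ‖1 - (starRingEnd ℂ) l * w‖ :=
      (by linarith : 1 - r ≤ 1 - ‖l‖).trans (one_sub_norm_le_norm_one_sub_conj_mul hw.le)
    have hA : ‖(starRingEnd ℂ) (blaschkeProd τ z) *
        (((1 - ‖l‖ ^ 2 : ℝ) : ℂ) / (starRingEnd ℂ) (1 - (starRingEnd ℂ) l * z))‖ ≤ 2 := by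
      rw [norm_mul, RCLike.norm_conj]
      exact (mul_le_mul (norm_blaschkeProd_le_one hτ1 hz) hκz (norm_nonneg _) zero_le_one).trans
        (by norm_num)
    have h1 : ‖deriv (blaschkeProd τ) w * (1 - (starRingEnd ℂ) l * w)⁻¹‖ ≤
        n * (2 / (1 - r)) * (1 - r)⁻¹ := by
      rw [norm_mul, norm_inv]
      gcongr
      exact norm_deriv_blaschkeProd_le (fun i => hσ _) hr hw.le
    have h2 : ‖blaschkeProd τ w * (- -(starRingEnd ℂ) l / (1 - (starRingEnd ℂ) l * w) ^ 2)‖ ≤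
        1 * (1 / (1 - r) ^ 2) := by
      rw [norm_mul, norm_div, neg_neg, RCLike.norm_conj, norm_pow]
      gcongr
      · exact norm_blaschkeProd_le_one hτ1 hw.le
      · exact (hσ1 _).le
    have h3 := mul_le_mul hA ((norm_add_le _ _).trans (add_le_add h1 h2)) (norm_nonneg _)
      two_pos.le
    rw [← norm_mul] at h3
    refine (add_le_add (ih (σ := τ) fun i => hσ _) h3).trans ?_
    have hi : (0 : ℝ) ≤ ((1 - r) ^ 2)⁻¹ := by positivity
    have : 4 * (((n + 1 : ℕ) : ℝ) / (1 - r)) ^ 2 - (4 * ((n : ℝ) / (1 - r)) ^ 2 +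
        2 * (n * (2 / (1 - r)) * (1 - r)⁻¹ + 1 * (1 / (1 - r) ^ 2))) =
        (4 * n + 2) * ((1 - r) ^ 2)⁻¹ := by
      push_cast
      field_simp
      ring
    have := this ▸ (by positivity : (0 : ℝ) ≤ (4 * n + 2) * ((1 - r) ^ 2)⁻¹)
    linarith

/-- The pointwise estimate `|k'| ≲ min(N, 1/(1-|w|)) · min(N, 1/|1 - conj(z) w|)`. -/
lemma norm_deriv_modelKernel_le (hσ : ∀ i, ‖σ i‖ ≤ r) (hr : r < 1) (hn : 1 ≤ n)
    (hz : ‖z‖ ≤ 1) (hw : ‖w‖ < 1) :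
    ‖deriv (modelKernel σ z) w‖ ≤ 16 * (n / (1 - r)) ^ 2 *
      ((1 + n / (1 - r) * (1 - ‖w‖)) * (1 + n / (1 - r) * ‖1 - (starRingEnd ℂ) z * w‖))⁻¹ := by
  have hσ1 : ∀ i, ‖σ i‖ < 1 := fun i => (hσ i).trans_lt hr
  have hN : 0 < (n : ℝ) / (1 - r) := div_pos (by exact_mod_cast hn) (by linarith)
  have hB : ‖deriv (blaschkeProd σ) w‖ ≤ 2 * (n / (1 - r)) :=
    (norm_deriv_blaschkeProd_le hσ hr hw.le).trans (le_of_eq (by ring))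
  have hB' := norm_deriv_blaschkeProd_le_div hσ1 hw
  have hk := norm_deriv_modelKernel_le_sq hσ hr hz hw
  have hs : 0 < 1 - ‖w‖ := by linarith
  have hsd : 1 - ‖w‖ ≤ ‖1 - (starRingEnd ℂ) z * w‖ := by
    have h := norm_sub_norm_le (1 : ℂ) ((starRingEnd ℂ) z * w)
    rw [norm_one, norm_mul, RCLike.norm_conj] at h
    nlinarith [norm_nonneg w]
  have hd : 0 < ‖1 - (starRingEnd ℂ) z * w‖ := hs.trans_le hsd
  have hkd : ‖deriv (modelKernel σ z) w‖ ≤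
      ‖deriv (blaschkeProd σ) w‖ / ‖1 - (starRingEnd ℂ) z * w‖ +
        2 / ‖1 - (starRingEnd ℂ) z * w‖ ^ 2 := by
    have hBz := norm_blaschkeProd_le_one hσ1 hz
    have hBw := norm_blaschkeProd_le_one hσ1 hw.le
    rw [(hasDerivAt_modelKernel hσ1 hz hw).deriv]
    refine (norm_add_le _ _).trans ?_
    rw [norm_div, norm_div, norm_neg, norm_mul, norm_mul, norm_pow, RCLike.norm_conj,
      RCLike.norm_conj]
    gcongr
    · exact mul_le_of_le_one_left (norm_nonneg _) hBz
    · have : ‖1 - (starRingEnd ℂ) (blaschkeProd σ z) * blaschkeProd σ w‖ ≤ 1 + 1 := by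
        refine (norm_sub_le _ _).trans ?_
        rw [norm_one, norm_mul, RCLike.norm_conj]
        gcongr
        exact mul_le_one₀ hBz (norm_nonneg _) hBw
      calc _ ≤ (1 + 1) * (1 : ℝ) := by gcongr
        _ = 2 := by norm_num
  have hK0 := norm_nonneg (deriv (modelKernel σ z) w)
  generalize ‖deriv (modelKernel σ z) w‖ = K at *
  generalize ‖deriv (blaschkeProd σ) w‖ = b at *
  generalize ‖1 - (starRingEnd ℂ) z * w‖ = d at *
  generalize (n : ℝ) / (1 - r) = N at *
  generalize 1 - ‖w‖ = s at *
  rw [← div_eq_mul_inv, le_div_iff₀ (by positivity)]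
  rcases le_total (N * d) 1 with h | h
  · have h' : N * s ≤ 1 := (mul_le_mul_of_nonneg_left hsd hN.le).trans h
    calc K * ((1 + N * s) * (1 + N * d)) ≤ 4 * N ^ 2 * ((1 + 1) * (1 + 1)) := by gcongr
      _ = 16 * N ^ 2 := by ring
  · have hbs : b * (1 + N * s) ≤ 3 * N := by
      rw [le_div_iff₀ hs] at hB'
      nlinarith
    have hds : 1 + N * s ≤ 2 * (N * d) := by nlinarith
    calc K * ((1 + N * s) * (1 + N * d))
        ≤ (b / d + 2 / d ^ 2) * ((1 + N * s) * (2 * (N * d))) := by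
          gcongr
          · exact hK0.trans hkd
          · linarith
      _ = 2 * N * (b * (1 + N * s)) + 4 * N / d * (1 + N * s) := by field_simp; ring
      _ ≤ 2 * N * (3 * N) + 4 * N / d * (2 * (N * d)) := by gcongr
      _ = 14 * N ^ 2 := by field_simp; ring
      _ ≤ 16 * N ^ 2 := by nlinarith [sq_nonneg N]

end BlaschkeEstimates

section WeightedIntegrals

open MeasureTheory Set

lemma abs_div_pi_le_norm_one_sub_mul_exp {a θ : ℝ} (ha0 : 0 ≤ a) (hθ : |θ| ≤ Real.pi) :
    |θ| / Real.pi ≤ ‖1 - (a : ℂ) * (Real.cos θ + Real.sin θ * I)‖ := by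
  refine abs_le_of_sq_le_sq' ?_ (norm_nonneg _) |>.2
  have hy1 : (|θ| / Real.pi) ^ 2 ≤ 1 :=
    pow_le_one₀ (by positivity) (div_le_one_of_le₀ hθ Real.pi_pos.le)
  have hcos : Real.cos θ ≤ 1 - 2 * (|θ| / Real.pi) ^ 2 := by
    have h := Real.cos_le_one_sub_mul_cos_sq hθ
    rw [div_pow, sq_abs]
    linarith [show 2 / Real.pi ^ 2 * θ ^ 2 = 2 * (θ ^ 2 / Real.pi ^ 2) by ring]
  have hy0 := sq_nonneg (|θ| / Real.pi)
  generalize (|θ| / Real.pi) ^ 2 = y at *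
  have : ‖1 - (a : ℂ) * (Real.cos θ + Real.sin θ * I)‖ ^ 2 =
      (1 - a) ^ 2 + 2 * a * (1 - Real.cos θ) := by
    rw [Complex.sq_norm, Complex.normSq_apply]
    simp [-Complex.ofReal_cos, -Complex.ofReal_sin]
    nlinarith [Real.sin_sq_add_cos_sq θ]
  rw [this]
  nlinarith [mul_nonneg ha0 (sub_nonneg.2 hcos), mul_nonneg (sq_nonneg (1 - a)) (sub_nonneg.2 hy1),
    mul_nonneg ha0 hy0, mul_nonneg (sq_nonneg a) hy0]

/-- The radial profile `u ↦ u^γ (1+u)^{-p}` on the positive half-line. -/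
def radialProfile (γ p : ℝ) : ℝ → ℝ :=
  (Ioi 0).indicator fun u => u ^ γ * (1 + u) ^ (-p)

lemma radialProfile_nonneg (γ p u : ℝ) : 0 ≤ radialProfile γ p u :=
  indicator_nonneg (fun u (hu : 0 < u) => by positivity) u

lemma integrable_radialProfile {γ p : ℝ} (hγ : -1 < γ) (hp : γ - p < -1) :
    Integrable (radialProfile γ p) := by
  rw [radialProfile, integrable_indicator_iff measurableSet_Ioi,
    ← Ioc_union_Ioi_eq_Ioi zero_le_one]
  have hm : Measurable fun u : ℝ => u ^ γ * (1 + u) ^ (-p) := by fun_prop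
  refine IntegrableOn.union ?_ ?_
  · have h := (intervalIntegrable_iff_integrableOn_Ioc_of_le zero_le_one).1
      (intervalIntegral.intervalIntegrable_rpow' (a := 0) (b := 1) hγ)
    refine Integrable.mono' h hm.aestronglyMeasurable
      ((ae_restrict_iff' measurableSet_Ioc).2 (.of_forall fun u hu => ?_))
    have hu0 : 0 < u := hu.1
    rw [Real.norm_of_nonneg (by positivity)]
    exact mul_le_of_le_one_right (by positivity)
      (Real.rpow_le_one_of_one_le_of_nonpos (by linarith) (by linarith))
  · refine Integrable.mono' (integrableOn_Ioi_rpow_of_lt hp one_pos) hm.aestronglyMeasurable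
      ((ae_restrict_iff' measurableSet_Ioi).2 (.of_forall fun u (hu : 1 < u) => ?_))
    have hu0 : 0 < u := by linarith
    rw [Real.norm_of_nonneg (by positivity), sub_eq_add_neg, Real.rpow_add hu0]
    exact mul_le_mul_of_nonneg_left
      (Real.rpow_le_rpow_of_nonpos hu0 (by linarith) (by linarith)) (by positivity)

/-- The angular profile `x ↦ (1+|x|)^{-p}`. -/
def angularProfile (p x : ℝ) : ℝ := (1 + ‖x‖) ^ (-p)

lemma angularProfile_nonneg (p x : ℝ) : 0 ≤ angularProfile p x := by
  unfold angularProfile; positivity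

lemma integrable_angularProfile {p : ℝ} (hp : 1 < p) : Integrable (angularProfile p) :=
  integrable_one_add_norm (by simpa using hp)

lemma exists_circle_conj_mul_eq_norm (z : ℂ) :
    ∃ u : Circle, ∀ w : ℂ, (starRingEnd ℂ) z * (u * w) = ‖z‖ * w := by
  refine ⟨Circle.exp (arg z), fun w => ?_⟩
  have h := norm_mul_exp_arg_mul_I z
  have hu : (starRingEnd ℂ) (Circle.exp (arg z) : ℂ) * (Circle.exp (arg z) : ℂ) = 1 := by
    rw [← Complex.normSq_eq_conj_mul_self, Circle.normSq_coe, ofReal_one]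
  rw [← Circle.coe_exp] at h
  have h' := congrArg (starRingEnd ℂ) h
  rw [map_mul, conj_ofReal] at h'
  rw [← h']
  linear_combination (‖z‖ : ℂ) * w * hu

/-- A nonnegative function on the disc dominated in rotated polar coordinates by a product
`g ρ * h θ` has integral at most `(∫ g) * (∫ h)`. -/
lemma integral_ball_le_of_polar_le (u : Circle) {F : ℂ → ℝ} {g h : ℝ → ℝ}
    (hF : ∀ w ∈ ball (0 : ℂ) 1, 0 ≤ F w) (hg0 : ∀ ρ, 0 ≤ g ρ) (hh0 : ∀ θ, 0 ≤ h θ)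
    (hg : Integrable g) (hh : Integrable h)
    (hle : ∀ ρ θ : ℝ, 0 < ρ → ρ < 1 → |θ| ≤ Real.pi →
      ρ * F (u * (ρ * (Real.cos θ + Real.sin θ * I))) ≤ g ρ * h θ) :
    ∫ w in ball (0 : ℂ) 1, F w ≤ (∫ ρ, g ρ) * ∫ θ, h θ := by
  have hgh : Integrable (fun p : ℝ × ℝ => g p.1 * h p.2) := hg.mul_prod hh
  have hG : ∀ w, 0 ≤ (ball (0 : ℂ) 1).indicator F w := fun w => indicator_nonneg hF w
  have hnn : ∀ p : ℝ × ℝ, 0 ≤ g p.1 * h p.2 := fun p => mul_nonneg (hg0 _) (hh0 _)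
  have hT : MeasurableSet polarCoord.target := polarCoord.open_target.measurableSet
  rw [← integral_indicator measurableSet_ball,
    ← (rotation u).measurePreserving.integral_comp
      (rotation u).toHomeomorph.measurableEmbedding,
    ← Complex.integral_comp_polarCoord_symm]
  calc _ ≤ ∫ p in polarCoord.target, g p.1 * h p.2 := by
        refine integral_mono_of_nonneg ((ae_restrict_iff' hT).2 (.of_forall fun p hp => ?_))
          hgh.integrableOn ((ae_restrict_iff' hT).2 (.of_forall fun p hp => ?_))
        · exact mul_nonneg (le_of_lt hp.1) (hG _)
        · have hp1 : 0 < p.1 := hp.1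
          have hp2 : |p.2| ≤ Real.pi := abs_le.2 ⟨hp.2.1.le, hp.2.2.le⟩
          simp only [smul_eq_mul, rotation_apply, Complex.polarCoord_symm_apply]
          by_cases hlt : p.1 < 1
          · rw [indicator_of_mem]
            · exact hle _ _ hp1 hlt hp2
            · rw [mem_ball_zero_iff, norm_mul, Circle.norm_coe, one_mul,
                ← Complex.polarCoord_symm_apply, Complex.norm_polarCoord_symm, abs_of_pos hp1]
              exact hlt
          · rw [indicator_of_notMem, mul_zero]
            · exact hnn p
            · rw [mem_ball_zero_iff, norm_mul, Circle.norm_coe, one_mul,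
                ← Complex.polarCoord_symm_apply, Complex.norm_polarCoord_symm, abs_of_pos hp1]
              exact hlt
    _ ≤ ∫ p : ℝ × ℝ, g p.1 * h p.2 := setIntegral_le_integral hgh (.of_forall hnn)
    _ = (∫ ρ, g ρ) * ∫ θ, h θ := integral_prod_mul g h

/-- Separation of variables in polar coordinates: the `ε`-part of the decay in `d` is moved to
the radial factor. -/
lemma polar_weight_bound {q γ ε N M ρ x d θ : ℝ} (hq : 1 < q) (hε : 0 < ε) (hεq : ε ≤ q)
    (hN : 0 < N) (hM : 0 ≤ M) (hρ0 : 0 < ρ) (hρ1 : ρ < 1) (hx0 : 0 ≤ x)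
    (hx : x ≤ M * ((1 + N * (1 - ρ)) * (1 + N * d))⁻¹) (hsd : 1 - ρ ≤ d)
    (hd : |θ| / Real.pi ≤ d) :
    ρ * (x ^ q * (1 - ρ ^ 2) ^ γ) ≤
      2 ^ |γ| * M ^ q * N ^ (-γ) * radialProfile γ (q + ε) (N * (1 - ρ)) *
        angularProfile (q - ε) (N / Real.pi * θ) := by
  have hs : 0 < 1 - ρ := sub_pos.2 hρ1
  have hd0 : 0 < d := hs.trans_le hsd
  have hxq : x ^ q ≤ M ^ q * ((1 + N * (1 - ρ)) ^ (-q) * ((1 + N * (1 - ρ)) ^ (-ε) *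
      (1 + ‖N / Real.pi * θ‖) ^ (-(q - ε)))) := by
    have h1 : (1 + N * d) ^ (-ε) ≤ (1 + N * (1 - ρ)) ^ (-ε) :=
      Real.rpow_le_rpow_of_nonpos (by positivity) (by gcongr) (by linarith)
    have h2 : (1 + N * d) ^ (-(q - ε)) ≤ (1 + ‖N / Real.pi * θ‖) ^ (-(q - ε)) := by
      refine Real.rpow_le_rpow_of_nonpos (by positivity) ?_ (by linarith)
      rw [norm_mul, Real.norm_of_nonneg (by positivity : 0 ≤ N / Real.pi), Real.norm_eq_abs,
        div_mul_eq_mul_div, ← mul_div_assoc']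
      gcongr
    calc x ^ q ≤ (M * ((1 + N * (1 - ρ)) * (1 + N * d))⁻¹) ^ q := by gcongr
      _ = M ^ q * ((1 + N * (1 - ρ)) ^ (-q) * ((1 + N * d) ^ (-ε) *
          (1 + N * d) ^ (-(q - ε)))) := by
        rw [← Real.rpow_add (by positivity), show -ε + -(q - ε) = -q by ring,
          ← Real.mul_rpow (by positivity) (by positivity), Real.mul_rpow hM (by positivity),
          Real.inv_rpow (by positivity), ← Real.rpow_neg (by positivity)]
      _ ≤ _ := by gcongr
  have hγ : (1 - ρ ^ 2) ^ γ ≤ (1 - ρ) ^ γ * 2 ^ |γ| := by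
    rw [show 1 - ρ ^ 2 = (1 - ρ) * (1 + ρ) by ring, Real.mul_rpow hs.le (by positivity)]
    gcongr
    calc (1 + ρ) ^ γ ≤ (1 + ρ) ^ |γ| :=
          Real.rpow_le_rpow_of_exponent_le (by linarith) (le_abs_self γ)
      _ ≤ 2 ^ |γ| := by gcongr; linarith
  have hρ2 : 0 ≤ 1 - ρ ^ 2 := by nlinarith
  calc ρ * (x ^ q * (1 - ρ ^ 2) ^ γ) ≤ x ^ q * (1 - ρ ^ 2) ^ γ :=
        mul_le_of_le_one_left (by positivity) hρ1.le
    _ ≤ _ := mul_le_mul hxq hγ (by positivity) (by positivity)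
    _ = _ := by
        rw [radialProfile, indicator_of_mem (show N * (1 - ρ) ∈ Ioi 0 by exact mul_pos hN hs),
          angularProfile, Real.mul_rpow hN.le hs.le, neg_add, Real.rpow_add (by positivity),
          Real.rpow_neg hN.le]
        have : N ^ γ ≠ 0 := by positivity
        field_simp

/-- The integral of `((1 + N(1-|w|)) (1 + N|1 - conj(z) w|))^{-q} (1-|w|²)^γ` over the disc is
`O(N^{-γ-2})`. -/
lemma exists_integral_ball_le {q γ : ℝ} (hq : 1 < q) (hγ1 : -1 < γ) (hγ2 : γ ≤ q - 1) :
    ∃ K : ℝ, 0 ≤ K ∧ ∀ (N : ℝ), 0 < N → ∀ (M : ℝ), 0 ≤ M → ∀ (z : ℂ), ‖z‖ ≤ 1 →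
      ∀ f : ℂ → ℂ, (∀ w, ‖w‖ < 1 → ‖f w‖ ≤ M * ((1 + N * (1 - ‖w‖)) *
        (1 + N * ‖1 - (starRingEnd ℂ) z * w‖))⁻¹) →
      ∫ w in ball (0 : ℂ) 1, ‖f w‖ ^ q * (1 - ‖w‖ ^ 2) ^ γ ≤ K * (M ^ q * N ^ (-γ - 2)) := by
  set ε := (q - 1) / 2 with hε
  have hε0 : 0 < ε := by rw [hε]; linarith
  have hΦ := integrable_radialProfile (γ := γ) (p := q + ε) hγ1 (by linarith)
  have hΨ := integrable_angularProfile (p := q - ε) (by rw [hε]; linarith)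
  set A := ∫ x, radialProfile γ (q + ε) x with hA
  set B := ∫ x, angularProfile (q - ε) x with hB
  have hA0 : 0 ≤ A := integral_nonneg (radialProfile_nonneg _ _)
  have hB0 : 0 ≤ B := integral_nonneg (angularProfile_nonneg _)
  refine ⟨2 ^ |γ| * A * (Real.pi * B), by positivity, fun N hN M hM z hz f hf => ?_⟩
  obtain ⟨u, hu⟩ := exists_circle_conj_mul_eq_norm z
  have hNpi : N / Real.pi ≠ 0 := by positivity
  set g : ℝ → ℝ := fun ρ =>
    2 ^ |γ| * M ^ q * N ^ (-γ) * radialProfile γ (q + ε) (N * (1 - ρ)) with hg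
  set h : ℝ → ℝ := fun θ => angularProfile (q - ε) (N / Real.pi * θ) with hh
  have key := integral_ball_le_of_polar_le u
    (F := fun w => ‖f w‖ ^ q * (1 - ‖w‖ ^ 2) ^ γ) (g := g) (h := h)
    (fun w hw => ?_) (fun ρ => mul_nonneg (by positivity) (radialProfile_nonneg _ _ _))
    (fun θ => angularProfile_nonneg _ _)
    (((hΦ.comp_mul_left' hN.ne').comp_sub_left 1).const_mul _) (hΨ.comp_mul_left' hNpi)
    (fun ρ θ hρ0 hρ1 hθ => ?_)
  · refine key.trans_eq ?_
    rw [hg, hh, integral_const_mul,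
      integral_sub_left_eq_self (fun x => radialProfile γ (q + ε) (N * x)) volume 1,
      Measure.integral_comp_mul_left, Measure.integral_comp_mul_left, ← hA, ← hB,
      abs_of_pos (inv_pos.2 hN), abs_of_pos (show 0 < (N / Real.pi)⁻¹ by positivity), smul_eq_mul, smul_eq_mul,
      show -γ - 2 = -γ + (-1) + (-1) by ring, Real.rpow_add hN, Real.rpow_add hN,
      Real.rpow_neg_one]
    field_simp
  · have : 0 ≤ 1 - ‖w‖ ^ 2 := by
      nlinarith [norm_nonneg w, mem_ball_zero_iff.1 hw]
    positivity
  · have hnorm : ‖(u : ℂ) * (ρ * (Real.cos θ + Real.sin θ * I))‖ = ρ := by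
      rw [norm_mul, Circle.norm_coe, one_mul, ← Complex.polarCoord_symm_apply (ρ, θ),
        Complex.norm_polarCoord_symm, abs_of_pos hρ0]
    have hfw := hf _ (hnorm.trans_lt hρ1)
    have hd := abs_div_pi_le_norm_one_sub_mul_exp (a := ‖z‖ * ρ)
      (by positivity) hθ
    have hsd : 1 - ρ ≤ ‖1 - (starRingEnd ℂ) z * (u * (ρ * (Real.cos θ + Real.sin θ * I)))‖ := by
      have h := norm_sub_norm_le (1 : ℂ)
        ((starRingEnd ℂ) z * (u * (ρ * (Real.cos θ + Real.sin θ * I))))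
      rw [norm_one, norm_mul, RCLike.norm_conj, hnorm] at h
      nlinarith
    rw [ofReal_mul, mul_assoc, ← hu] at hd
    rw [hnorm] at hfw
    simp only [hnorm]
    have hx0 := norm_nonneg (f (u * (ρ * (Real.cos θ + Real.sin θ * I))))
    have hs : 0 < 1 - ρ := sub_pos.2 hρ1
    exact polar_weight_bound hq hε0 (by rw [hε]; linarith) hN hM hρ0 hρ1 hx0 hfw hsd hd

end WeightedIntegrals

/-- Proposition 4.1, part (3): for `q ∈ (1, ∞)` and `γ ∈ (-1, q-1]`,
`‖(k_z^B)'‖_{A^q(γ)} ≤ C (n/(1-r))^{2-(γ+2)/q}`,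
where `r = max_i |λ_i|` and `|z| ≤ 1`. -/
theorem kernel_deriv_Bergman_estimate (q γ : ℝ) (hq : 1 < q)
    (hγ1 : -1 < γ) (hγ2 : γ ≤ q - 1) :
    ∃ C : ℝ, 0 < C ∧
      ∀ (n : ℕ), 1 ≤ n → ∀ σ : Fin n → ℂ,
      ∀ r : ℝ, (∀ i, ‖σ i‖ ≤ r) → r < 1 →
      ∀ z : ℂ, ‖z‖ ≤ 1 →
        bergmanNorm q γ (deriv (modelKernel σ z))
          ≤ C * ((n : ℝ) / (1 - r)) ^ (2 - (γ + 2) / q) := by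
  obtain ⟨K, hK0, hK⟩ := exists_integral_ball_le hq hγ1 hγ2
  refine ⟨(Real.pi⁻¹ * K * 16 ^ q) ^ (1 / q) + 1, by positivity, ?_⟩
  intro n hn σ r hσ hr z hz
  set N : ℝ := n / (1 - r)
  have hN : 0 < N := div_pos (by exact_mod_cast hn) (by linarith)
  have hI := hK N hN (16 * N ^ 2) (by positivity) z hz (deriv (modelKernel σ z))
    fun w hw => norm_deriv_modelKernel_le hσ hr hn hz hw
  have hI0 : 0 ≤ ∫ w in ball (0 : ℂ) 1,
      ‖deriv (modelKernel σ z) w‖ ^ q * (1 - ‖w‖ ^ 2) ^ γ := by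
    refine MeasureTheory.setIntegral_nonneg measurableSet_ball fun w hw => ?_
    have : 0 ≤ 1 - ‖w‖ ^ 2 := by nlinarith [norm_nonneg w, mem_ball_zero_iff.1 hw]
    positivity
  have hexp : (N ^ 2) ^ q * N ^ (-γ - 2) = N ^ ((2 - (γ + 2) / q) * q) := by
    rw [← Real.rpow_natCast N 2, ← Real.rpow_mul hN.le, ← Real.rpow_add hN]
    congr 1
    push_cast
    field_simp
    ring
  calc bergmanNorm q γ (deriv (modelKernel σ z))
      ≤ (Real.pi⁻¹ * (K * ((16 * N ^ 2) ^ q * N ^ (-γ - 2)))) ^ (1 / q) := by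
        unfold bergmanNorm
        gcongr
    _ = (Real.pi⁻¹ * K * 16 ^ q) ^ (1 / q) * N ^ (2 - (γ + 2) / q) := by
        rw [Real.mul_rpow (x := 16) (by positivity) (by positivity), mul_assoc (16 ^ q), hexp,
          show Real.pi⁻¹ * (K * (16 ^ q * N ^ ((2 - (γ + 2) / q) * q))) =
            Real.pi⁻¹ * K * 16 ^ q * N ^ ((2 - (γ + 2) / q) * q) by ring,
          Real.mul_rpow (by positivity) (by positivity), ← Real.rpow_mul hN.le,
          mul_assoc _ q, mul_one_div_cancel (by positivity), mul_one]
    _ ≤ _ := by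
        gcongr
        linarith
end
end

section
/- For every integer l ≥ 2, every q ∈ (1, ∞), and every γ ∈ (−1, q] there exists a constant C > 0 (depending only on l, q and γ) such that: for every n ≥ 1, every σ = (λ_1, …, λ_n) ∈ D^n with r = max_i |λ_i|, and every z ∈ ℂ with |z| ≤ 1, the l-th derivative of the reproducing kernel k_z^B (B = B_σ) satisfies ‖(k_z^B)^{(l)}‖_{A^q(γ)} ≤ C · (n/(1−r))^{l+1−(γ+2)/q}. (Corollary 4.2.) -/
open Complex Metric

noncomputable section

open scoped ComplexConjugate Nat

section BlaschkeBounds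

theorem norm_sub_le_norm_one_sub_conj_mul {l v : ℂ} (hl : ‖l‖ ≤ 1) (hv : ‖v‖ ≤ 1) :
    ‖l - v‖ ≤ ‖1 - conj l * v‖ := by
  have key : ‖1 - conj l * v‖ ^ 2 = ‖l - v‖ ^ 2 + (1 - ‖l‖ ^ 2) * (1 - ‖v‖ ^ 2) := by
    simp only [← Complex.normSq_eq_norm_sq, Complex.normSq_apply, sub_re, sub_im, mul_re, mul_im,
      conj_re, conj_im, one_re, one_im]
    ring
  refine (sq_le_sq₀ (norm_nonneg _) (norm_nonneg _)).1 ?_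
  have h1 : 0 ≤ 1 - ‖l‖ ^ 2 := by nlinarith [norm_nonneg l]
  have h2 : 0 ≤ 1 - ‖v‖ ^ 2 := by nlinarith [norm_nonneg v]
  nlinarith [mul_nonneg h1 h2]

theorem half_one_sub_le_norm_one_sub_conj_mul {l u : ℂ} {r δ : ℝ} (hl : ‖l‖ ≤ r) (hr : r < 1)
    (hδ : 0 ≤ δ) (hδr : δ ≤ (1 - r) / 2) (hu : ‖u‖ ≤ 1 + δ) :
    (1 - r) / 2 ≤ ‖1 - conj l * u‖ := by
  have h1 : ‖conj l * u‖ ≤ r * (1 + δ) := by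
    rw [norm_mul, RCLike.norm_conj]
    exact mul_le_mul hl hu (norm_nonneg _) ((norm_nonneg _).trans hl)
  have h2 := norm_sub_norm_le (1 : ℂ) (conj l * u)
  rw [norm_one] at h2
  nlinarith

theorem norm_blaschkeF_le {l u : ℂ} {r δ : ℝ} (hl : ‖l‖ ≤ r) (hr : r < 1)
    (hδ : 0 ≤ δ) (hδr : δ ≤ (1 - r) / 2) (hu : ‖u‖ ≤ 1 + δ) :
    ‖blaschkeF l u‖ ≤ 1 + 4 * δ / (1 - r) := by
  have hd := half_one_sub_le_norm_one_sub_conj_mul hl hr hδ hδr hu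
  have hr' : 0 < 1 - r := by linarith
  have hδ1 : (0 : ℝ) < 1 + δ := by linarith
  have hl1 : ‖l‖ ≤ 1 := hl.trans hr.le
  obtain ⟨v, hv, huv⟩ : ∃ v : ℂ, ‖v‖ ≤ 1 ∧ ‖u - v‖ ≤ δ := by
    refine ⟨((1 + δ)⁻¹ : ℝ) * u, ?_, ?_⟩
    · rw [norm_mul, Complex.norm_real, Real.norm_of_nonneg (by positivity), inv_mul_le_iff₀ hδ1]
      linarith
    · have : u - ((1 + δ)⁻¹ : ℝ) * u = ((δ * (1 + δ)⁻¹ : ℝ) : ℂ) * u := by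
        rw [show δ * (1 + δ)⁻¹ = 1 - (1 + δ)⁻¹ by field_simp; ring]
        push_cast; ring
      rw [this, norm_mul, Complex.norm_real, Real.norm_of_nonneg (by positivity), mul_assoc]
      have : (1 + δ)⁻¹ * ‖u‖ ≤ 1 := by rw [inv_mul_le_iff₀ hδ1]; linarith
      nlinarith
  have h1 := norm_sub_le_norm_one_sub_conj_mul hl1 hv
  have h2 : ‖l - u‖ ≤ ‖l - v‖ + δ := by
    have := norm_sub_le (l - v) (u - v)
    rw [show l - v - (u - v) = l - u by ring] at this
    linarith
  have h3 : ‖1 - conj l * v‖ ≤ ‖1 - conj l * u‖ + δ := by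
    have := norm_add_le (1 - conj l * u) (conj l * (u - v))
    rw [show 1 - conj l * u + conj l * (u - v) = 1 - conj l * v by ring, norm_mul,
      RCLike.norm_conj] at this
    nlinarith [norm_nonneg (u - v), norm_nonneg l]
  have hd0 : 0 < ‖1 - conj l * u‖ := by linarith
  rw [blaschkeF, norm_div, div_le_iff₀ hd0]
  have h4 : 2 * δ ≤ 4 * δ / (1 - r) * ‖1 - conj l * u‖ := by
    rw [div_mul_eq_mul_div, le_div_iff₀ hr']
    nlinarith
  linarith

variable {n : ℕ} {σ : Fin n → ℂ} {r δ : ℝ}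

theorem norm_blaschkeProd_le_three (hn : 1 ≤ n) (hσ : ∀ i, ‖σ i‖ ≤ r) (hr : r < 1)
    (hδ : δ = (1 - r) / (4 * n)) {u : ℂ} (hu : ‖u‖ ≤ 1 + δ) : ‖blaschkeProd σ u‖ ≤ 3 := by
  have hn' : (1 : ℝ) ≤ n := by exact_mod_cast hn
  have hr' : 0 < 1 - r := by linarith
  have hδ0 : 0 ≤ δ := by rw [hδ]; positivity
  have hδr : δ ≤ (1 - r) / 2 := by
    rw [hδ]; gcongr; linarith
  rw [blaschkeProd, norm_prod]
  calc ∏ i, ‖blaschkeF (σ i) u‖ ≤ ∏ _i : Fin n, (1 + 4 * δ / (1 - r)) :=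
        Finset.prod_le_prod (fun i _ => norm_nonneg _)
          fun i _ => norm_blaschkeF_le (hσ i) hr hδ0 hδr hu
    _ = (1 + 1 / n) ^ n := by
        rw [Finset.prod_const, Finset.card_univ, Fintype.card_fin, hδ]
        congr 2; field_simp
    _ ≤ Real.exp (1 / n) ^ n := by
        gcongr; linarith [Real.add_one_le_exp (1 / (n : ℝ))]
    _ = Real.exp 1 := by rw [← Real.exp_nat_mul]; congr 1; field_simp
    _ ≤ 3 := Real.exp_one_lt_three.le

theorem differentiableOn_blaschkeProd (hσ : ∀ i, ‖σ i‖ ≤ r) (hr : r < 1)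
    (hδ : 0 ≤ δ) (hδr : δ ≤ (1 - r) / 2) :
    DifferentiableOn ℂ (blaschkeProd σ) (ball 0 (1 + δ)) := by
  refine DifferentiableOn.fun_finsetProd fun i _ => ?_
  refine DifferentiableOn.div (by fun_prop) (by fun_prop) fun u hu => ?_
  have := half_one_sub_le_norm_one_sub_conj_mul (hσ i) hr hδ hδr (mem_ball_zero_iff.1 hu).le
  exact norm_pos_iff.1 (by linarith)

theorem conj_blaschkeF_mul_blaschkeF {l z u : ℂ} (hu : conj z * u = 1)
    (h1 : 1 - conj l * u ≠ 0) (h2 : 1 - conj l * z ≠ 0) :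
    conj (blaschkeF l z) * blaschkeF l u = 1 := by
  have h2' : 1 - l * conj z ≠ 0 := by
    intro h; apply h2; rw [← map_eq_zero (starRingEnd ℂ)]; simpa using h
  simp only [blaschkeF, map_div₀, map_sub, map_mul, map_one, conj_conj]
  rw [div_mul_div_comm, div_eq_one_iff_eq (mul_ne_zero h2' h1)]
  linear_combination (1 - conj l * l) * hu

theorem exists_kernel_extension (hσ : ∀ i, ‖σ i‖ ≤ r) (hr : r < 1)
    (hδ : 0 ≤ δ) (hδr : δ ≤ (1 - r) / 2) {z : ℂ} (hz : ‖z‖ ≤ 1) :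
    ∃ F : ℂ → ℂ, DifferentiableOn ℂ F (ball 0 (1 + δ)) ∧
      (∀ u ∈ ball (0 : ℂ) (1 + δ),
        (1 - conj z * u) * F u = 1 - conj (blaschkeProd σ z) * blaschkeProd σ u) ∧
      ∀ u ∈ ball (0 : ℂ) 1, modelKernel σ z u = F u := by
  set g : ℂ → ℂ := fun u => 1 - conj (blaschkeProd σ z) * blaschkeProd σ u with hgdef
  have hg : DifferentiableOn ℂ g (ball 0 (1 + δ)) :=
    ((differentiableOn_blaschkeProd hσ hr hδ hδr).const_mul _).const_sub _
  have hne : ∀ u ∈ ball (0 : ℂ) 1, 1 - conj z * u ≠ 0 := by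
    intro u hu h
    have h1 : ‖conj z * u‖ = 1 := by rw [← sub_eq_zero.1 h, norm_one]
    rw [norm_mul, RCLike.norm_conj] at h1
    have := mem_ball_zero_iff.1 hu
    nlinarith [norm_nonneg u, norm_nonneg z]
  suffices ∃ F : ℂ → ℂ, DifferentiableOn ℂ F (ball 0 (1 + δ)) ∧
      ∀ u ∈ ball (0 : ℂ) (1 + δ), (1 - conj z * u) * F u = g u by
    obtain ⟨F, hF, hFg⟩ := this
    refine ⟨F, hF, hFg, fun u hu => ?_⟩
    rw [modelKernel, div_eq_iff (hne u hu), mul_comm (F u),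
      hFg u (ball_subset_ball (by linarith) hu)]
  by_cases h : ∃ a ∈ ball (0 : ℂ) (1 + δ), 1 - conj z * a = 0
  · obtain ⟨a, ha, hza⟩ := h
    have hza' : conj z * a = 1 := (sub_eq_zero.1 hza).symm
    have hga : g a = 0 := by
      simp only [hgdef, blaschkeProd, map_prod]
      rw [← Finset.prod_mul_distrib, Finset.prod_eq_one, sub_self]
      intro i _
      refine conj_blaschkeF_mul_blaschkeF hza' ?_ ?_ <;> refine norm_pos_iff.1 ?_
      · have := half_one_sub_le_norm_one_sub_conj_mul (hσ i) hr hδ hδr (mem_ball_zero_iff.1 ha).le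
        linarith
      · have := half_one_sub_le_norm_one_sub_conj_mul (u := z) (hσ i) hr hδ hδr (by linarith)
        linarith
    refine ⟨fun u => -a * dslope g a u, ?_, fun u _ => ?_⟩
    · exact ((Complex.differentiableOn_dslope (isOpen_ball.mem_nhds ha)).2 hg).const_mul _
    · have hs := sub_smul_dslope g a u
      rw [hga, sub_zero, smul_eq_mul] at hs
      rw [← hs]
      linear_combination u * dslope g a u * hza'
  · push Not at h
    exact ⟨fun u => g u / (1 - conj z * u), hg.div (by fun_prop) h,
      fun u hu => mul_div_cancel₀ _ (h u hu)⟩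

end BlaschkeBounds

section KernelDerivative

variable {n : ℕ} {σ : Fin n → ℂ} {r δ : ℝ}

theorem exists_radius_forall_sphere_le_norm (hδ : 0 < δ) (hδ4 : δ ≤ 1 / 4) {z w : ℂ}
    (hz : ‖z‖ ≤ 1) (hw : ‖w‖ < 1) :
    ∃ R : ℝ, (δ + 1 - ‖w‖) / 32 ≤ R ∧ R ≤ (δ + 1 - ‖w‖) / 8 ∧
      ∀ u ∈ sphere w R, (δ + ‖1 - conj z * w‖) / 34 ≤ ‖1 - conj z * u‖ := by
  set d := ‖1 - conj z * w‖ with hd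
  set t := (δ + 1 - ‖w‖) / 32 with ht
  have hw0 := norm_nonneg w
  have hz0 := norm_nonneg z
  have key : ∀ R, ∀ u ∈ sphere w R, ‖conj z * (u - w)‖ = ‖z‖ * R := by
    intro R u hu
    rw [norm_mul, RCLike.norm_conj, mem_sphere_iff_norm.1 hu]
  by_cases h : 2 * t ≤ d
  · refine ⟨t, le_rfl, by linarith, fun u hu => ?_⟩
    have h1 := norm_sub_norm_le (1 - conj z * w) (conj z * (u - w))
    rw [key t u hu, show 1 - conj z * w - conj z * (u - w) = 1 - conj z * u by ring] at h1
    nlinarith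
  · push Not at h
    refine ⟨4 * t, by linarith, by linarith, fun u hu => ?_⟩
    have h1 := norm_sub_norm_le (conj z * (u - w)) (1 - conj z * w)
    rw [key _ u hu, show conj z * (u - w) - (1 - conj z * w) = -(1 - conj z * u) by ring,
      norm_neg] at h1
    have h2 := norm_sub_norm_le (1 : ℂ) (conj z * w)
    rw [norm_one, norm_mul, RCLike.norm_conj] at h2
    have h3 : 3 / 4 ≤ ‖z‖ := by nlinarith
    nlinarith

theorem norm_iteratedDeriv_modelKernel_le (hn : 1 ≤ n) (hσ : ∀ i, ‖σ i‖ ≤ r) (hr : r < 1)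
    (hδ : δ = (1 - r) / (4 * n)) {z w : ℂ} (hz : ‖z‖ ≤ 1) (hw : ‖w‖ < 1) (l : ℕ) :
    ‖iteratedDeriv l (modelKernel σ z) w‖ ≤
      (l ! * 340 * 32 ^ l) * (((δ + 1 - ‖w‖) ^ l)⁻¹ * (δ + ‖1 - conj z * w‖)⁻¹) := by
  have hn' : (1 : ℝ) ≤ n := by exact_mod_cast hn
  have hr0 : 0 ≤ r := (norm_nonneg _).trans (hσ ⟨0, hn⟩)
  have hr' : 0 < 1 - r := by linarith
  have hδ0 : 0 < δ := by rw [hδ]; positivity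
  have hδr : δ ≤ (1 - r) / 2 := by
    rw [hδ]; gcongr; linarith
  have hδ4 : δ ≤ 1 / 4 := by
    rw [hδ]; gcongr <;> linarith
  obtain ⟨F, hF, hFg, hkF⟩ := exists_kernel_extension hσ hr hδ0.le hδr hz
  have heq : modelKernel σ z =ᶠ[nhds w] F :=
    Filter.eventuallyEq_of_mem (isOpen_ball.mem_nhds (mem_ball_zero_iff.2 hw)) hkF
  rw [heq.iteratedDeriv_eq]
  obtain ⟨R, hR1, hR2, hR⟩ := exists_radius_forall_sphere_le_norm hδ0 hδ4 hz hw
  have hτ : 0 < (δ + 1 - ‖w‖) / 32 := by linarith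
  have hD : 0 < δ + ‖1 - conj z * w‖ := by positivity
  have hsub : closedBall w R ⊆ ball 0 (1 + δ) := by
    intro u hu
    have h1 := mem_closedBall_iff_norm.1 hu
    have h2 := norm_add_le (u - w) w
    rw [sub_add_cancel] at h2
    rw [mem_ball_zero_iff]
    linarith
  have hbound : ∀ u ∈ sphere w R, ‖F u‖ ≤ 340 * (δ + ‖1 - conj z * w‖)⁻¹ := by
    intro u hu
    have hub := hsub (sphere_subset_closedBall hu)
    have h1 := hR u hu
    have h2 : ‖1 - conj (blaschkeProd σ z) * blaschkeProd σ u‖ ≤ 10 := by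
      refine (norm_sub_le _ _).trans ?_
      rw [norm_one, norm_mul, RCLike.norm_conj]
      have := norm_blaschkeProd_le_three hn hσ hr hδ (mem_ball_zero_iff.1 hub).le
      have := norm_blaschkeProd_le_three hn hσ hr hδ (u := z) (by linarith)
      nlinarith [norm_nonneg (blaschkeProd σ z), norm_nonneg (blaschkeProd σ u)]
    rw [← hFg u hub, norm_mul] at h2
    rw [← div_eq_mul_inv, le_div_iff₀ hD]
    nlinarith [norm_nonneg (F u)]
  refine (Complex.norm_iteratedDeriv_le_of_forall_mem_sphere_norm_le l (hτ.trans_le hR1)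
    (hF.diffContOnCl_ball hsub) hbound).trans ?_
  calc l ! * (340 * (δ + ‖1 - conj z * w‖)⁻¹) / R ^ l
      ≤ l ! * (340 * (δ + ‖1 - conj z * w‖)⁻¹) / ((δ + 1 - ‖w‖) / 32) ^ l := by gcongr
    _ = _ := by rw [div_pow]; field_simp

end KernelDerivative

section WeightIntegrals

open MeasureTheory

theorem exists_lintegral_Ioi_rpow_le {γ p : ℝ} (hγ : -1 < γ) (hp : γ + 1 < p) :
    ∃ A : ℝ, 0 ≤ A ∧ ∀ δ : ℝ, 0 < δ →
      ∫⁻ x in Set.Ioi (0 : ℝ), ENNReal.ofReal ((δ + x) ^ (-p) * x ^ γ) ≤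
        ENNReal.ofReal (A * δ ^ (γ + 1 - p)) := by
  set f : ℝ → ℝ → ℝ := fun δ x => (δ + x) ^ (-p) * x ^ γ with hf
  have hmeas : ∀ δ, Measurable (f δ) := fun δ => by fun_prop
  have hint : IntegrableOn (f 1) (Set.Ioi 0) := by
    rw [← Set.Ioc_union_Ioi_eq_Ioi zero_le_one, integrableOn_union]
    constructor
    · have h1 : IntegrableOn (fun x : ℝ => x ^ γ) (Set.Ioc 0 1) :=
        (intervalIntegral.intervalIntegrable_rpow' hγ).1
      refine Integrable.mono' h1 (hmeas 1).aestronglyMeasurable ?_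
      refine (ae_restrict_iff' measurableSet_Ioc).2 (.of_forall fun x hx => ?_)
      have hx0 : 0 < x := hx.1
      rw [Real.norm_of_nonneg (by positivity)]
      refine mul_le_of_le_one_left (by positivity) ?_
      exact Real.rpow_le_one_of_one_le_of_nonpos (by linarith) (by linarith)
    · have h1 : IntegrableOn (fun x : ℝ => x ^ (γ - p)) (Set.Ioi 1) :=
        integrableOn_Ioi_rpow_of_lt (by linarith) one_pos
      refine Integrable.mono' h1 (hmeas 1).aestronglyMeasurable ?_
      refine (ae_restrict_iff' measurableSet_Ioi).2 (.of_forall fun x hx => ?_)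
      have hx0 : 0 < x := one_pos.trans hx
      rw [Real.norm_of_nonneg (by positivity), sub_eq_neg_add, Real.rpow_add hx0]
      refine mul_le_mul_of_nonneg_right ?_ (by positivity)
      exact Real.rpow_le_rpow_of_nonpos hx0 (by linarith) (by linarith)
  refine ⟨∫ x in Set.Ioi 0, f 1 x, setIntegral_nonneg measurableSet_Ioi fun x hx => ?_,
    fun δ hδ => ?_⟩
  · have hx0 : 0 < x := hx
    positivity
  have hscale : ∀ x ∈ Set.Ioi (0 : ℝ), f δ (δ * x) = δ ^ (γ - p) * f 1 x := by
    intro x hx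
    have hx0 : 0 < x := hx
    simp only [hf]
    rw [show δ + δ * x = δ * (1 + x) by ring, Real.mul_rpow hδ.le (by positivity),
      Real.mul_rpow hδ.le hx0.le, sub_eq_neg_add, Real.rpow_add hδ]
    ring
  have hintδ : IntegrableOn (f δ) (Set.Ioi 0) := by
    have := (integrableOn_Ioi_comp_mul_left_iff (f δ) 0 hδ).1
    rw [mul_zero] at this
    refine this ((integrableOn_congr_fun hscale measurableSet_Ioi).2 ?_)
    exact hint.const_mul _
  rw [← ofReal_integral_eq_lintegral_ofReal hintδ]
  · refine ENNReal.ofReal_le_ofReal (le_of_eq ?_)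
    have h := integral_comp_mul_left_Ioi (f δ) 0 hδ
    rw [mul_zero, setIntegral_congr_fun measurableSet_Ioi hscale, integral_const_mul,
      smul_eq_mul, eq_inv_mul_iff_mul_eq₀ hδ.ne'] at h
    rw [← h, show γ + 1 - p = 1 + (γ - p) by ring, Real.rpow_add hδ, Real.rpow_one]
    ring
  · refine (ae_restrict_iff' measurableSet_Ioi).2 (.of_forall fun x hx => ?_)
    have hx0 : 0 < x := hx
    simp only [Pi.zero_apply, hf]
    positivity

theorem exists_lintegral_add_abs_rpow_le {q : ℝ} (hq : 1 < q) :
    ∃ A : ℝ, 0 ≤ A ∧ ∀ δ : ℝ, 0 < δ →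
      ∫⁻ x : ℝ, ENNReal.ofReal ((δ + |x|) ^ (-q)) ≤ ENNReal.ofReal (A * δ ^ (1 - q)) := by
  set f : ℝ → ℝ → ℝ := fun δ x => (δ + |x|) ^ (-q) with hf
  have hint : Integrable (f 1) := integrable_one_add_norm (by simpa using hq)
  refine ⟨∫ x, f 1 x, integral_nonneg fun x => by simp only [hf, Pi.zero_apply]; positivity,
    fun δ hδ => ?_⟩
  have hscale : ∀ x, f δ (δ * x) = δ ^ (-q) * f 1 x := by
    intro x
    simp only [hf]
    rw [abs_mul, abs_of_pos hδ, show δ + δ * |x| = δ * (1 + |x|) by ring,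
      Real.mul_rpow hδ.le (by positivity)]
  have hintδ : Integrable (f δ) := by
    refine (integrable_comp_mul_left_iff (f δ) hδ.ne').1 ?_
    simp only [hscale]
    exact hint.const_mul _
  rw [← ofReal_integral_eq_lintegral_ofReal hintδ
    (.of_forall fun x => by simp only [hf, Pi.zero_apply]; positivity)]
  refine ENNReal.ofReal_le_ofReal (le_of_eq ?_)
  have h := Measure.integral_comp_mul_left (f δ) δ
  simp only [hscale] at h
  rw [integral_const_mul, smul_eq_mul, abs_of_pos (inv_pos.2 hδ),
    eq_inv_mul_iff_mul_eq₀ hδ.ne'] at h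
  rw [← h, show 1 - q = 1 + (-q) by ring, Real.rpow_add hδ, Real.rpow_one]
  ring

theorem abs_div_pi_le_norm_one_sub {ρ θ : ℝ} (h0 : 0 ≤ ρ) (h1 : ρ ≤ 1) (hθ : |θ| ≤ Real.pi) :
    |θ| / Real.pi ≤ ‖1 - (ρ : ℂ) * exp (I * θ)‖ := by
  have hsin := Real.mul_abs_le_abs_sin (x := θ / 2) (by rw [abs_div, abs_two]; linarith)
  have hexp := Complex.norm_exp_I_mul_ofReal_sub_one θ
  rw [norm_mul, Real.norm_two, Real.norm_eq_abs] at hexp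
  rw [abs_div, abs_two] at hsin
  set e := exp (I * θ)
  have he : ‖e‖ = 1 := by simp [e, norm_exp]
  have h2 := norm_sub_norm_le (1 : ℂ) (ρ * e)
  rw [norm_one, norm_mul, he, Complex.norm_real, Real.norm_of_nonneg h0] at h2
  have h3 := norm_sub_le ((1 - ρ : ℂ) * e) (1 - ρ * e)
  rw [show (1 - ρ : ℂ) * e - (1 - ρ * e) = e - 1 by ring, norm_mul, he,
    ← Complex.ofReal_one, ← Complex.ofReal_sub, Complex.norm_real,
    Real.norm_of_nonneg (by linarith), Complex.ofReal_one] at h3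
  have h4 : 2 / Real.pi * (|θ| / 2) = |θ| / Real.pi := by ring
  linarith

/-- A majorant of the weighted `q`-th power of a kernel derivative, with `p = l * q`. -/
def kernelMajorant (p q γ δ : ℝ) (z w : ℂ) : ℝ :=
  (δ + 1 - ‖w‖) ^ (-p) * (δ + ‖1 - conj z * w‖) ^ (-q) * (1 - ‖w‖ ^ 2) ^ γ

theorem lintegral_kernelMajorant_eq (p q γ δ : ℝ) (z : ℂ) :
    ∫⁻ w in ball (0 : ℂ) 1, ENNReal.ofReal (kernelMajorant p q γ δ z w) =
      ∫⁻ w in ball (0 : ℂ) 1, ENNReal.ofReal (kernelMajorant p q γ δ ‖z‖ w) := by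
  obtain ⟨c, hc⟩ : ∃ c : Circle, (c : ℂ) * ‖z‖ = z :=
    ⟨Circle.exp z.arg, by rw [Circle.coe_exp, mul_comm, Complex.norm_mul_exp_arg_mul_I]⟩
  rw [← lintegral_indicator measurableSet_ball, ← lintegral_indicator measurableSet_ball,
    ← (rotation c).measurePreserving.lintegral_comp_emb
      (rotation c).toHomeomorph.measurableEmbedding]
  congr 1 with w
  have hcc : conj (c : ℂ) * c = 1 := by
    rw [mul_comm, Complex.mul_conj, Circle.normSq_coe, ofReal_one]
  have h1 : conj z * (c * w) = conj (‖z‖ : ℂ) * w := by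
    conv_lhs => rw [← hc]
    rw [map_mul]
    linear_combination conj (‖z‖ : ℂ) * w * hcc
  simp only [Set.indicator, mem_ball_zero_iff, rotation_apply, kernelMajorant, norm_mul,
    Circle.norm_coe, one_mul, h1]

theorem exists_lintegral_kernelMajorant_le {p q γ : ℝ} (hγ : -1 < γ) (hp : γ + 1 < p)
    (hq : 1 < q) :
    ∃ K : ℝ, 0 ≤ K ∧ ∀ δ : ℝ, 0 < δ → ∀ z : ℂ, ‖z‖ ≤ 1 →
      ∫⁻ w in ball (0 : ℂ) 1, ENNReal.ofReal (kernelMajorant p q γ δ z w) ≤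
        ENNReal.ofReal (K * δ ^ (γ + 2 - p - q)) := by
  obtain ⟨A, hA, hAδ⟩ := exists_lintegral_Ioi_rpow_le hγ hp
  obtain ⟨A', hA', hAδ'⟩ := exists_lintegral_add_abs_rpow_le hq
  refine ⟨2 ^ |γ| * Real.pi ^ q * A * A', by positivity, fun δ hδ z hz => ?_⟩
  rw [lintegral_kernelMajorant_eq, ← lintegral_indicator measurableSet_ball,
    ← Complex.lintegral_comp_polarCoord_symm, polarCoord_target]
  set g : ℝ → ENNReal := (Set.Ioi (0 : ℝ)).indicator
    fun x => ENNReal.ofReal ((δ + x) ^ (-p) * x ^ γ) with hg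
  set h : ℝ → ENNReal := fun x => ENNReal.ofReal ((δ + |x|) ^ (-q)) with hh
  have hgm : Measurable g := Measurable.indicator (by fun_prop) measurableSet_Ioi
  have hhm : Measurable h := by fun_prop
  set M : ℝ := 2 ^ |γ| * Real.pi ^ q with hM
  have hpt : ∀ x ∈ Set.Ioi (0 : ℝ) ×ˢ Set.Ioo (-Real.pi) Real.pi,
      ENNReal.ofReal x.1 • (ball (0 : ℂ) 1).indicator
        (fun w => ENNReal.ofReal (kernelMajorant p q γ δ ‖z‖ w)) (Complex.polarCoord.symm x) ≤
      ENNReal.ofReal M * (g (1 - x.1) * h x.2) := by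
    rintro ⟨s, θ⟩ ⟨hs, hθ⟩
    have hs0 : 0 < s := hs
    have hw : Complex.polarCoord.symm (s, θ) = s * exp (I * θ) := by
      rw [Complex.polarCoord_symm_apply, mul_comm I, exp_mul_I]
      push_cast; rfl
    have hwn : ‖(s * exp (I * θ) : ℂ)‖ = s := by
      rw [norm_mul, mul_comm I, Complex.norm_exp_ofReal_mul_I, mul_one, Complex.norm_real,
        Real.norm_of_nonneg hs0.le]
    rw [hw]
    by_cases hs1 : s < 1
    swap
    · rw [Set.indicator_of_notMem (by rwa [mem_ball_zero_iff, hwn])]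
      simp
    rw [Set.indicator_of_mem (by rwa [mem_ball_zero_iff, hwn]), hg, hh,
      Set.indicator_of_mem (by simpa using hs1), smul_eq_mul,
      ← ENNReal.ofReal_mul hs0.le, ← ENNReal.ofReal_mul (by positivity),
      ← ENNReal.ofReal_mul (by positivity)]
    refine ENNReal.ofReal_le_ofReal ?_
    have hs1' : 0 < 1 - s := by linarith
    have hd := abs_div_pi_le_norm_one_sub (ρ := ‖z‖ * s) (θ := θ) (by positivity)
      (by nlinarith [norm_nonneg z]) (abs_le.2 ⟨hθ.1.le, hθ.2.le⟩)
    have hang : (δ + ‖1 - conj (‖z‖ : ℂ) * (s * exp (I * θ))‖) ^ (-q) ≤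
        Real.pi ^ q * (δ + |θ|) ^ (-q) := by
      have h1 : (δ + |θ|) / Real.pi ≤ δ + ‖1 - conj (‖z‖ : ℂ) * (s * exp (I * θ))‖ := by
        rw [Complex.conj_ofReal, ← mul_assoc, ← Complex.ofReal_mul, add_div]
        have : δ / Real.pi ≤ δ := div_le_self hδ.le (by linarith [Real.pi_gt_three])
        linarith
      refine (Real.rpow_le_rpow_of_nonpos (by positivity) h1 (by linarith)).trans_eq ?_
      rw [Real.div_rpow (by positivity) (by positivity), Real.rpow_neg Real.pi_pos.le, div_inv_eq_mul,
        mul_comm]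
    have hrad : (1 - s ^ 2) ^ γ ≤ 2 ^ |γ| * (1 - s) ^ γ := by
      rw [show 1 - s ^ 2 = (1 + s) * (1 - s) by ring, Real.mul_rpow (by positivity) hs1'.le]
      refine mul_le_mul_of_nonneg_right ?_ (by positivity)
      calc (1 + s) ^ γ ≤ (1 + s) ^ |γ| :=
            Real.rpow_le_rpow_of_exponent_le (by linarith) (le_abs_self γ)
        _ ≤ 2 ^ |γ| := Real.rpow_le_rpow (by positivity) (by linarith) (abs_nonneg γ)
    have hs2 : 0 ≤ 1 - s ^ 2 := by nlinarith
    have hδs : 0 < δ + 1 - s := by linarith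
    rw [kernelMajorant, hwn, show δ + (1 - s) = δ + 1 - s by ring]
    calc s * ((δ + 1 - s) ^ (-p) * (δ + ‖1 - conj (‖z‖ : ℂ) * (s * exp (I * θ))‖) ^ (-q) *
          (1 - s ^ 2) ^ γ)
        ≤ 1 * ((δ + 1 - s) ^ (-p) * (Real.pi ^ q * (δ + |θ|) ^ (-q)) *
          (2 ^ |γ| * (1 - s) ^ γ)) := by gcongr
      _ = _ := by rw [hM]; ring
  calc _ ≤ ∫⁻ x in Set.Ioi (0 : ℝ) ×ˢ Set.Ioo (-Real.pi) Real.pi,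
        ENNReal.ofReal M * (g (1 - x.1) * h x.2) :=
        setLIntegral_mono' (measurableSet_Ioi.prod measurableSet_Ioo) hpt
    _ ≤ ∫⁻ x : ℝ × ℝ, ENNReal.ofReal M * (g (1 - x.1) * h x.2) :=
        setLIntegral_le_lintegral _ _
    _ = ENNReal.ofReal M * ((∫⁻ x, g x) * ∫⁻ x, h x) := by
        rw [lintegral_const_mul _ (by fun_prop), Measure.volume_eq_prod,
          lintegral_prod_mul (f := fun x => g (1 - x)) (by fun_prop) hhm.aemeasurable,
          lintegral_sub_left_eq_self]
    _ ≤ ENNReal.ofReal M *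
        (ENNReal.ofReal (A * δ ^ (γ + 1 - p)) * ENNReal.ofReal (A' * δ ^ (1 - q))) := by
        rw [hg, lintegral_indicator measurableSet_Ioi]
        gcongr
        · exact hAδ δ hδ
        · exact hAδ' δ hδ
    _ = _ := by
        rw [← ENNReal.ofReal_mul (by positivity), ← ENNReal.ofReal_mul (by positivity),
          show γ + 2 - p - q = (γ + 1 - p) + (1 - q) by ring, Real.rpow_add hδ]
        congr 1; ring

end WeightIntegrals

/-- Corollary 4.2: for every integer `l ≥ 2`, `q ∈ (1, ∞)` and `γ ∈ (-1, q]`,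
`‖(k_z^B)^{(l)}‖_{A^q(γ)} ≤ C (n/(1-r))^{l+1-(γ+2)/q}`,
where `r = max_i |λ_i|` and `|z| ≤ 1`. -/
theorem kernel_higher_deriv_Bergman_estimate (l : ℕ) (hl : 2 ≤ l) (q γ : ℝ)
    (hq : 1 < q) (hγ1 : -1 < γ) (hγ2 : γ ≤ q) :
    ∃ C : ℝ, 0 < C ∧
      ∀ (n : ℕ), 1 ≤ n → ∀ σ : Fin n → ℂ,
      ∀ r : ℝ, (∀ i, ‖σ i‖ ≤ r) → r < 1 →
      ∀ z : ℂ, ‖z‖ ≤ 1 →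
        bergmanNorm q γ (iteratedDeriv l (modelKernel σ z))
          ≤ C * ((n : ℝ) / (1 - r)) ^ ((l : ℝ) + 1 - (γ + 2) / q) := by
  obtain ⟨K, hK, hKδ⟩ := exists_lintegral_kernelMajorant_le (p := l * q) (q := q) hγ1
    (by have : (2 : ℝ) ≤ l := by exact_mod_cast hl
        nlinarith) hq
  obtain ⟨c, hc⟩ : ∃ c : ℝ, c = l ! * 340 * 32 ^ l := ⟨_, rfl⟩
  have hc0 : 0 < c := by rw [hc]; positivity
  have hq0 : 0 < q := by linarith
  set e : ℝ := (l : ℝ) + 1 - (γ + 2) / q with he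
  refine ⟨(Real.pi⁻¹ * (c ^ q * (K + 1))) ^ (1 / q) * 4 ^ e, by positivity, ?_⟩
  intro n hn σ r hσ hr z hz
  have hn' : (1 : ℝ) ≤ n := by exact_mod_cast hn
  have hr' : 0 < 1 - r := by linarith
  obtain ⟨δ, hδ⟩ : ∃ δ : ℝ, δ = (1 - r) / (4 * n) := ⟨_, rfl⟩
  have hδ0 : 0 < δ := by rw [hδ]; positivity
  set f : ℂ → ℝ := fun w =>
    ‖iteratedDeriv l (modelKernel σ z) w‖ ^ q * (1 - ‖w‖ ^ 2) ^ γ with hf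
  have hpt : ∀ w ∈ ball (0 : ℂ) 1,
      ENNReal.ofReal ‖f w‖ ≤
        ENNReal.ofReal (c ^ q) * ENNReal.ofReal (kernelMajorant (l * q) q γ δ z w) := by
    intro w hw
    have hw1 := mem_ball_zero_iff.1 hw
    have hw2 : 0 ≤ 1 - ‖w‖ ^ 2 := by nlinarith [norm_nonneg w]
    have hτ : 0 < δ + 1 - ‖w‖ := by linarith
    rw [← ENNReal.ofReal_mul (by positivity), Real.norm_of_nonneg (by positivity)]
    refine ENNReal.ofReal_le_ofReal ?_
    rw [hf, kernelMajorant, ← mul_assoc]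
    refine mul_le_mul_of_nonneg_right ?_ (by positivity)
    refine (Real.rpow_le_rpow (norm_nonneg _)
      (norm_iteratedDeriv_modelKernel_le hn hσ hr hδ hz hw1 l) hq0.le).trans_eq ?_
    rw [← hc, Real.mul_rpow hc0.le (by positivity), Real.mul_rpow (by positivity) (by positivity),
      Real.inv_rpow (by positivity), Real.inv_rpow (by positivity), ← Real.rpow_natCast _ l,
      ← Real.rpow_mul hτ.le, Real.rpow_neg hτ.le, Real.rpow_neg (by positivity)]
  have hint : ∫ w in ball (0 : ℂ) 1, f w ≤ c ^ q * (K + 1) * δ ^ (-(e * q)) := by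
    refine (Real.le_norm_self _).trans ((MeasureTheory.norm_integral_le_lintegral_norm _).trans ?_)
    refine ENNReal.toReal_le_of_le_ofReal (by positivity) ?_
    refine (MeasureTheory.setLIntegral_mono' measurableSet_ball hpt).trans ?_
    rw [MeasureTheory.lintegral_const_mul' _ _ ENNReal.ofReal_ne_top, mul_assoc,
      ENNReal.ofReal_mul (by positivity)]
    gcongr
    refine (hKδ δ hδ0 z hz).trans (ENNReal.ofReal_le_ofReal ?_)
    rw [show -(e * q) = γ + 2 - l * q - q by rw [he]; field_simp; ring]
    gcongr
    linarith
  have hδN : δ⁻¹ = 4 * (n / (1 - r)) := by rw [hδ, inv_div, mul_div_assoc]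
  calc bergmanNorm q γ (iteratedDeriv l (modelKernel σ z))
      ≤ (Real.pi⁻¹ * (c ^ q * (K + 1) * δ ^ (-(e * q)))) ^ (1 / q) := by
        rw [bergmanNorm]
        refine Real.rpow_le_rpow (mul_nonneg (by positivity) ?_) (by gcongr) (by positivity)
        refine MeasureTheory.setIntegral_nonneg measurableSet_ball fun w hw => ?_
        have hw1 := mem_ball_zero_iff.1 hw
        have hw2 : 0 ≤ 1 - ‖w‖ ^ 2 := by nlinarith [norm_nonneg w]
        positivity
    _ = (Real.pi⁻¹ * (c ^ q * (K + 1))) ^ (1 / q) * (δ⁻¹) ^ e := by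
        rw [← mul_assoc, Real.mul_rpow (by positivity) (by positivity), ← Real.rpow_mul hδ0.le,
          show -(e * q) * (1 / q) = -e by field_simp, Real.rpow_neg hδ0.le,
          Real.inv_rpow hδ0.le]
    _ = _ := by
        rw [hδN, Real.mul_rpow (x := 4) (by norm_num) (by positivity), ← mul_assoc]
end
end
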